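/- arXiv:1209.6544 — 3 statements merged into one kernel-verified Lean document; each statement's English description precedes it below -/
import Mathlib

section
/- Let k be an algebraically closed field of characteristic zero and n ≥ 2. Let M, N ∈ M_n(k) have homogeneous blocks M₁, N₁ ∈ M_{n−1}(k), respectively. If M ∼_sf N, then M₁ and N₁ are congruent, i.e. M₁ = Qᵀ·N₁·Q for some Q ∈ GL_{n−1}(k). -/
open Matrix

/-- The homogeneous block (top-left `(n-1)×(n-1)` block) of an `n×n` matrix. -/
def homBlock {k : Type*} [Field k] {m : ℕ}
    (M : Matrix (Fin (m + 1)) (Fin (m + 1)) k) : Matrix (Fin m) (Fin m) k :=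
  M.submatrix Fin.castSucc Fin.castSucc

/-- The standard-form map `sf`, sending `(M₁ M₂; M₃ᵀ m)` to `(M₁ M₂+M₃; 0 m)`. -/
def sf {k : Type*} [Field k] {m : ℕ}
    (M : Matrix (Fin (m + 1)) (Fin (m + 1)) k) : Matrix (Fin (m + 1)) (Fin (m + 1)) k :=
  Matrix.of fun i j =>
    if i = Fin.last m then (if j = Fin.last m then M i j else 0)
    else if j = Fin.last m then M i j + M j i
    else M i j

/-- Membership in `𝒫_n`: block form `(P₁ P₂; 0 1)` with `P₁ ∈ GL_{n-1}(k)`. -/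
def memP {k : Type*} [Field k] {m : ℕ}
    (P : Matrix (Fin (m + 1)) (Fin (m + 1)) k) : Prop :=
  IsUnit (homBlock P) ∧ P (Fin.last m) (Fin.last m) = 1 ∧
    ∀ j : Fin m, P (Fin.last m) (Fin.castSucc j) = 0

/-- Standard-form congruence. -/
def SfCongruent {k : Type*} [Field k] {m : ℕ}
    (M N : Matrix (Fin (m + 1)) (Fin (m + 1)) k) : Prop :=
  ∃ P : Matrix (Fin (m + 1)) (Fin (m + 1)) k, memP P ∧
    ∃ α : k, α ≠ 0 ∧ sf M = α • sf (Pᵀ * N * P)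

theorem stmt_9 (k : Type*) [Field k] [IsAlgClosed k] [CharZero k]
    (m : ℕ) (hm : 1 ≤ m)
    (M N : Matrix (Fin (m + 1)) (Fin (m + 1)) k) (h : SfCongruent M N) :
    ∃ Q : Matrix (Fin m) (Fin m) k, IsUnit Q ∧ homBlock M = Qᵀ * homBlock N * Q := by
  obtain ⟨P, ⟨hU, -, h0⟩, α, hα, hs⟩ := h
  obtain ⟨c, hc⟩ := IsAlgClosed.exists_pow_nat_eq α (n := 2) (by norm_num)
  have hc0 : c ≠ 0 := by
    rintro rfl
    apply hα
    rw [← hc]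
    simp
  refine ⟨c • homBlock P, ?_, ?_⟩
  · have := hU.smul (Units.mk0 c hc0)
    simpa [Units.smul_def] using this
  · ext i j
    have hij := congrFun (congrFun hs i.castSucc) j.castSucc
    simp only [sf, Matrix.of_apply, Matrix.smul_apply, (Fin.castSucc_lt_last _).ne,
      if_false] at hij
    have hb : (Pᵀ * N * P) i.castSucc j.castSucc
        = ((homBlock P)ᵀ * homBlock N * homBlock P) i j := by
      simp [Matrix.mul_apply, Fin.sum_univ_castSucc, h0, homBlock]
    rw [hb] at hij
    simp only [homBlock, Matrix.submatrix_apply] at hij ⊢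
    rw [hij, ← hc]
    simp [pow_two, mul_assoc]
end

section
/- Let k be an algebraically closed field of characteristic zero and let f = a·x² + b·xy + c·yx + d·y² + α·x + β·y + γ·1 be an element of the free algebra k⟨x,y⟩ with a, b, c, d, α, β, γ ∈ k and (a,b,c,d) ≠ (0,0,0,0) (i.e. f has degree two). Then k⟨x,y | f⟩ is isomorphic as a k-algebra to k⟨x,y | g⟩ where g is one of the following: xy − q·yx for some q ∈ k^×; xy − q·yx − 1 for some q ∈ k^×; yx − xy + y²; yx − xy + y² + 1; yx − xy + y; x² + y; x²; x² − 1; yx; or yx − 1. -/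
noncomputable section

/-- The generator `x` of the free algebra `k⟨x,y⟩`. -/
def X (k : Type*) [Field k] : FreeAlgebra k (Fin 2) := FreeAlgebra.ι k 0

/-- The generator `y` of the free algebra `k⟨x,y⟩`. -/
def Y (k : Type*) [Field k] : FreeAlgebra k (Fin 2) := FreeAlgebra.ι k 1

/-- The relation identifying `f` with `0`. -/
def relOf (k : Type*) [Field k] (f : FreeAlgebra k (Fin 2)) :
    FreeAlgebra k (Fin 2) → FreeAlgebra k (Fin 2) → Prop :=
  fun a b => a = f ∧ b = 0

/-- `k⟨x, y | f⟩`: the free algebra on `x, y` modulo the two-sided ideal generated by `f`. -/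
abbrev QuotAlg (k : Type*) [Field k] (f : FreeAlgebra k (Fin 2)) := RingQuot (relOf k f)

/-- The two algebras are isomorphic. -/
def Iso (k : Type*) [Field k] (f g : FreeAlgebra k (Fin 2)) : Prop :=
  Nonempty (QuotAlg k f ≃ₐ[k] QuotAlg k g)

/-- Substitution endomorphism. -/
def sub (k : Type*) [Field k] (u v : FreeAlgebra k (Fin 2)) :
    FreeAlgebra k (Fin 2) →ₐ[k] FreeAlgebra k (Fin 2) := FreeAlgebra.lift k ![u, v]

@[simp] lemma sub_X (k : Type*) [Field k] (u v : FreeAlgebra k (Fin 2)) :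
    sub k u v (X k) = u := by simp [sub, X]

@[simp] lemma sub_Y (k : Type*) [Field k] (u v : FreeAlgebra k (Fin 2)) :
    sub k u v (Y k) = v := by simp [sub, Y]

lemma free_hom_ext {k : Type*} [Field k] {A : Type*} [Semiring A] [Algebra k A]
    {F G : FreeAlgebra k (Fin 2) →ₐ[k] A} (hx : F (X k) = G (X k)) (hy : F (Y k) = G (Y k)) :
    F = G := by
  apply FreeAlgebra.hom_ext
  funext i
  fin_cases i
  · exact hx
  · exact hy

lemma mk_self (k : Type*) [Field k] (f : FreeAlgebra k (Fin 2)) :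
    RingQuot.mkAlgHom k (relOf k f) f = 0 := by
  have := RingQuot.mkAlgHom_rel k (s := relOf k f) (x := f) (y := 0) ⟨rfl, rfl⟩
  simpa using this

/-- Induced map on quotients. -/
def indMap {k : Type*} [Field k] (f g : FreeAlgebra k (Fin 2))
    (F : FreeAlgebra k (Fin 2) →ₐ[k] FreeAlgebra k (Fin 2)) (c : k) (h : F f = c • g) :
    QuotAlg k f →ₐ[k] QuotAlg k g :=
  RingQuot.liftAlgHom k ⟨(RingQuot.mkAlgHom k (relOf k g)).comp F, by
    rintro x y ⟨rfl, rfl⟩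
    simp [h, mk_self]⟩

lemma indMap_mk {k : Type*} [Field k] (f g : FreeAlgebra k (Fin 2))
    (F : FreeAlgebra k (Fin 2) →ₐ[k] FreeAlgebra k (Fin 2)) (c : k) (h : F f = c • g)
    (z : FreeAlgebra k (Fin 2)) :
    indMap f g F c h (RingQuot.mkAlgHom k (relOf k f) z) = RingQuot.mkAlgHom k (relOf k g) (F z) := by
  simp [indMap]

lemma iso_of {k : Type*} [Field k] (f g u v u' v' : FreeAlgebra k (Fin 2)) (c : k) (hc : c ≠ 0)
    (h : sub k u v f = c • g) (h1 : sub k u v u' = X k) (h2 : sub k u v v' = Y k)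
    (h3 : sub k u' v' u = X k) (h4 : sub k u' v' v = Y k) : Iso k f g := by
  have e1 : (sub k u v).comp (sub k u' v') = AlgHom.id k _ :=
    free_hom_ext (by simp [h1]) (by simp [h2])
  have e2 : (sub k u' v').comp (sub k u v) = AlgHom.id k _ :=
    free_hom_ext (by simp [h3]) (by simp [h4])
  have e1' (z) : sub k u v (sub k u' v' z) = z := DFunLike.congr_fun e1 z
  have e2' (z) : sub k u' v' (sub k u v z) = z := DFunLike.congr_fun e2 z
  have h' : sub k u' v' g = c⁻¹ • f := by
    have := congrArg (sub k u' v') h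
    rw [e2', map_smul] at this
    rw [this, smul_smul, inv_mul_cancel₀ hc, one_smul]
  refine ⟨AlgEquiv.ofAlgHom (indMap f g _ c h) (indMap g f _ c⁻¹ h') ?_ ?_⟩
  · apply RingQuot.ringQuot_ext'
    ext z
    simp [indMap_mk, e1']
  · apply RingQuot.ringQuot_ext'
    ext z
    simp [indMap_mk, e2']

/-- The general polynomial. -/
def Q {k : Type*} [Field k] (a b c d α β γ : k) : FreeAlgebra k (Fin 2) :=
  a • (X k * X k) + b • (X k * Y k) + c • (Y k * X k) + d • (Y k * Y k)
      + α • X k + β • Y k + γ • (1 : FreeAlgebra k (Fin 2))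

lemma iso_affine {k : Type*} [Field k] (p q s r t w e : k) (hD : p * t - q * r ≠ 0) (he : e ≠ 0)
    {a b c d α β γ a' b' c' d' α' β' γ' : k}
    (ha : a * p * p + b * p * r + c * r * p + d * r * r = e * a')
    (hb : a * p * q + b * p * t + c * r * q + d * r * t = e * b')
    (hc : a * q * p + b * q * r + c * t * p + d * t * r = e * c')
    (hd : a * q * q + b * q * t + c * t * q + d * t * t = e * d')
    (hα : 2 * a * p * s + (b + c) * (p * w + r * s) + 2 * d * r * w + α * p + β * r = e * α')
    (hβ : 2 * a * q * s + (b + c) * (q * w + t * s) + 2 * d * t * w + α * q + β * t = e * β')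
    (hγ : a * s * s + (b + c) * s * w + d * w * w + α * s + β * w + γ = e * γ') :
    Iso k (Q a b c d α β γ) (Q a' b' c' d' α' β' γ') := by
  refine iso_of _ _ (p • X k + q • Y k + s • 1) (r • X k + t • Y k + w • 1)
    ((p * t - q * r)⁻¹ • (t • (X k - s • 1) - q • (Y k - w • 1)))
    ((p * t - q * r)⁻¹ • (p • (Y k - w • 1) - r • (X k - s • 1))) e he ?_ ?_ ?_ ?_ ?_
  · simp only [Q, map_add, map_smul, map_mul, map_one, sub_X, sub_Y, smul_add, smul_smul,
      ← ha, ← hb, ← hc, ← hd, ← hα, ← hβ, ← hγ]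
    simp only [mul_add, add_mul, smul_mul_assoc, mul_smul_comm, mul_one, one_mul]
    module
  all_goals
    simp only [map_add, map_sub, map_smul, map_one, sub_X, sub_Y]
    have hE := inv_mul_cancel₀ hD
    generalize (p * t - q * r)⁻¹ = E at hE ⊢
    match_scalars <;> grind

/-- The conclusion. -/
def Good (k : Type*) [Field k] (f : FreeAlgebra k (Fin 2)) : Prop :=
  (∃ q : k, q ≠ 0 ∧
      Nonempty (QuotAlg k f ≃ₐ[k] QuotAlg k (X k * Y k - q • (Y k * X k)))) ∨
  (∃ q : k, q ≠ 0 ∧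
      Nonempty (QuotAlg k f ≃ₐ[k] QuotAlg k (X k * Y k - q • (Y k * X k) - 1))) ∨
    Nonempty (QuotAlg k f ≃ₐ[k] QuotAlg k (Y k * X k - X k * Y k + Y k * Y k)) ∨
    Nonempty (QuotAlg k f ≃ₐ[k] QuotAlg k (Y k * X k - X k * Y k + Y k * Y k + 1)) ∨
    Nonempty (QuotAlg k f ≃ₐ[k] QuotAlg k (Y k * X k - X k * Y k + Y k)) ∨
    Nonempty (QuotAlg k f ≃ₐ[k] QuotAlg k (X k * X k + Y k)) ∨
    Nonempty (QuotAlg k f ≃ₐ[k] QuotAlg k (X k * X k)) ∨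
    Nonempty (QuotAlg k f ≃ₐ[k] QuotAlg k (X k * X k - 1)) ∨
    Nonempty (QuotAlg k f ≃ₐ[k] QuotAlg k (Y k * X k)) ∨
    Nonempty (QuotAlg k f ≃ₐ[k] QuotAlg k (Y k * X k - 1))

lemma Iso.tr {k : Type*} [Field k] {f g h : FreeAlgebra k (Fin 2)} (a : Iso k f g) (b : Iso k g h) :
    Iso k f h := by
  obtain ⟨a⟩ := a
  obtain ⟨b⟩ := b
  exact ⟨a.trans b⟩

lemma Good.of_iso {k : Type*} [Field k] {f g : FreeAlgebra k (Fin 2)} (h : Iso k f g)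
    (hg : Good k g) : Good k f := by
  unfold Good at *
  rcases hg with ⟨q, hq, h'⟩ | ⟨q, hq, h'⟩ | h' | h' | h' | h' | h' | h' | h' | h'
  · exact .inl ⟨q, hq, h.tr h'⟩
  · exact .inr (.inl ⟨q, hq, h.tr h'⟩)
  all_goals
    have := h.tr h'
    unfold Iso at this
    simp only [this, true_or, or_true]

lemma Iso.rfl {k : Type*} [Field k] (f : FreeAlgebra k (Fin 2)) : Iso k f f := ⟨AlgEquiv.refl⟩

lemma Iso.of_eq {k : Type*} [Field k] {f g : FreeAlgebra k (Fin 2)} (h : f = g) : Iso k f g :=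
  h ▸ Iso.rfl f

section
variable {k : Type*} [Field k]

lemma g1 (q : k) (hq : q ≠ 0) : Good k (Q 0 1 (-q) 0 0 0 0) :=
  .inl ⟨q, hq, Iso.of_eq (by unfold Q; module)⟩
lemma g2 (q : k) (hq : q ≠ 0) : Good k (Q 0 1 (-q) 0 0 0 (-1)) :=
  .inr (.inl ⟨q, hq, Iso.of_eq (by unfold Q; module)⟩)
lemma g3 : Good k (Q 0 (-1) 1 1 0 0 0) :=
  .inr (.inr (.inl (Iso.of_eq (by unfold Q; module))))
lemma g4 : Good k (Q 0 (-1) 1 1 0 0 1) :=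
  .inr (.inr (.inr (.inl (Iso.of_eq (by unfold Q; module)))))
lemma g5 : Good k (Q 0 (-1) 1 0 0 1 0) :=
  .inr (.inr (.inr (.inr (.inl (Iso.of_eq (by unfold Q; module))))))
lemma g6 : Good k (Q 1 0 0 0 0 1 0) :=
  .inr (.inr (.inr (.inr (.inr (.inl (Iso.of_eq (by unfold Q; module)))))))
lemma g7 : Good k (Q 1 0 0 0 0 0 0) :=
  .inr (.inr (.inr (.inr (.inr (.inr (.inl (Iso.of_eq (by unfold Q; module))))))))
lemma g8 : Good k (Q 1 0 0 0 0 0 (-1)) :=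
  .inr (.inr (.inr (.inr (.inr (.inr (.inr (.inl (Iso.of_eq (by unfold Q; module)))))))))
lemma g9 : Good k (Q 0 0 1 0 0 0 0) :=
  .inr (.inr (.inr (.inr (.inr (.inr (.inr (.inr (.inl (Iso.of_eq (by unfold Q; module))))))))))
lemma g10 : Good k (Q 0 0 1 0 0 0 (-1)) :=
  .inr (.inr (.inr (.inr (.inr (.inr (.inr (.inr (.inr (Iso.of_eq (by unfold Q; module))))))))))

/-- case `y x + …` -/
lemma case_yx (c α β γ : k) (hc : c ≠ 0) : Good k (Q 0 0 c 0 α β γ) := by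
  by_cases h : γ - α * β / c = 0
  · refine Good.of_iso (iso_affine 1 0 (-β / c) 0 1 (-α / c) c ?_ hc ?_ ?_ ?_ ?_ ?_ ?_ ?_) g9
    case refine_8 => refine Eq.trans ?_ (h.trans (mul_zero _).symm); field_simp; ring
    all_goals field_simp <;> ring_nf <;> simp
  · refine Good.of_iso (iso_affine (-(γ - α * β / c) / c) 0 (-β / c) 0 1 (-α / c)
      (-(γ - α * β / c)) ?_ (neg_ne_zero.2 h) ?_ ?_ ?_ ?_ ?_ ?_ ?_) g10
    case refine_1 => simpa using ⟨sub_ne_zero.1 (by simpa using h) |>.symm, hc⟩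
    all_goals field_simp <;> ring_nf <;> simp

/-- case `x y - q y x + …` with `q ≠ 0, 1` -/
lemma case_q (b c α β γ : k) (hb : b ≠ 0) (hc : c ≠ 0) (hbc : b + c ≠ 0) :
    Good k (Q 0 b c 0 α β γ) := by
  have hq : -c / b ≠ 0 := div_ne_zero (neg_ne_zero.2 hc) hb
  by_cases h : γ - α * β / (b + c) = 0
  · refine Good.of_iso (iso_affine 1 0 (-β / (b + c)) 0 1 (-α / (b + c)) b ?_ hb
      ?_ ?_ ?_ ?_ ?_ ?_ ?_) (g1 _ hq)
    case refine_8 => refine Eq.trans ?_ (h.trans (mul_zero _).symm); field_simp; ring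
    all_goals field_simp <;> ring_nf <;> simp
  · refine Good.of_iso (iso_affine (-(γ - α * β / (b + c)) / b) 0 (-β / (b + c)) 0 1
      (-α / (b + c)) (-(γ - α * β / (b + c))) ?_ (neg_ne_zero.2 h) ?_ ?_ ?_ ?_ ?_ ?_ ?_) (g2 _ hq)
    case refine_1 => simpa using ⟨sub_ne_zero.1 (by simpa using h) |>.symm, hb⟩
    all_goals field_simp <;> ring_nf <;> simp

/-- `b (x y - y x) + β y + γ` with `β ≠ 0` -/
lemma case_comm_y (b β γ : k) (hb : b ≠ 0) (h : β ≠ 0) : Good k (Q 0 b (-b) 0 0 β γ) := by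
  refine Good.of_iso (iso_affine (-β / b) 0 0 0 1 (-γ / β) β ?_ h ?_ ?_ ?_ ?_ ?_ ?_ ?_) g5
  case refine_1 => simpa using ⟨h, hb⟩
  all_goals field_simp <;> ring_nf <;> simp

/-- `b (x y - y x) + …` -/
lemma case_comm (b α β γ : k) (hb : b ≠ 0) : Good k (Q 0 b (-b) 0 α β γ) := by
  by_cases hα : α = 0
  · subst hα
    by_cases hβ : β = 0
    · subst hβ
      by_cases hγ : γ = 0
      · subst hγ
        refine Good.of_iso (iso_affine 1 0 0 0 1 0 b ?_ hb ?_ ?_ ?_ ?_ ?_ ?_ ?_)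
          (g1 1 one_ne_zero) <;> simp
      · refine Good.of_iso (iso_affine (-γ / b) 0 0 0 1 0 (-γ) ?_ (neg_ne_zero.2 hγ)
          ?_ ?_ ?_ ?_ ?_ ?_ ?_) (g2 1 one_ne_zero)
        case refine_1 => simpa using ⟨hγ, hb⟩
        all_goals field_simp <;> ring_nf <;> simp
    · exact case_comm_y b β γ hb hβ
  · refine Good.of_iso (iso_affine (-β / α) 1 0 1 0 0 1 ?_ one_ne_zero ?_ ?_ ?_ ?_ ?_ ?_ ?_)
      (case_comm_y (-b) α γ (neg_ne_zero.2 hb) hα)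
    case refine_1 => simp
    all_goals field_simp <;> ring_nf <;> simp

/-- `y x - x y + y ^ 2 + α x`, `α ≠ 0` -/
lemma case_jordan_x (α : k) (h : α ≠ 0) : Good k (Q 0 (-1) 1 1 α 0 0) := by
  have : Iso k (Q 0 (-1) 1 1 α 0 0) (Q 0 (-1) 1 0 α 0 0) := by
    refine iso_of _ _ (X k - α⁻¹ • (Y k * Y k)) (Y k) (X k + α⁻¹ • (Y k * Y k)) (Y k)
      1 one_ne_zero ?_ ?_ ?_ ?_ ?_
    · simp only [Q, map_add, map_smul, map_mul, map_one, sub_X, sub_Y, mul_sub, sub_mul,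
        smul_mul_assoc, mul_smul_comm, mul_assoc]
      match_scalars <;> field_simp <;> ring
    all_goals simp
  refine Good.of_iso this ?_
  simpa using case_comm (-1) α 0 0 (by simp)

variable [IsAlgClosed k] [CharZero k]

lemma exists_sq (z : k) : ∃ s, s * s = z := by
  obtain ⟨s, hs⟩ := IsAlgClosed.exists_pow_nat_eq z (n := 2) (by norm_num)
  exact ⟨s, by rw [← hs]; ring⟩

lemma case_jordan_aux (α γ : k) : Good k (Q 0 (-1) 1 1 α 0 γ) := by
  by_cases hα : α = 0
  · subst hα
    by_cases hγ : γ = 0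
    · subst hγ
      exact g3
    · obtain ⟨s, rfl⟩ := exists_sq γ
      have hs : s ≠ 0 := by rintro rfl; simp at hγ
      refine Good.of_iso (iso_affine s 0 0 0 s 0 (s * s) ?_ hγ ?_ ?_ ?_ ?_ ?_ ?_ ?_) g4 <;>
        simp [hs]
  · refine Good.of_iso (iso_affine 1 0 (-γ / α) 0 1 0 1 ?_ one_ne_zero ?_ ?_ ?_ ?_ ?_ ?_ ?_)
      (case_jordan_x α hα)
    all_goals field_simp <;> ring_nf <;> simp

lemma case_jordan (b d α β γ : k) (hb : b ≠ 0) (hd : d ≠ 0) : Good k (Q 0 b (-b) d α β γ) := by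
  refine Good.of_iso (iso_affine (-d / b) 0 0 0 1 (-β / (2 * d)) d ?_ hd ?_ ?_ ?_ ?_ ?_ ?_ ?_)
      (case_jordan_aux (-α / b) ((d * (β / (2 * d)) ^ 2 - β * (β / (2 * d)) + γ) / d))
  case refine_1 => simpa using ⟨hd, hb⟩
  all_goals field_simp <;> ring_nf <;> simp

lemma case_xx (a α β γ : k) (ha : a ≠ 0) : Good k (Q a 0 0 0 α β γ) := by
  by_cases hβ : β = 0
  · subst hβ
    by_cases h : γ - α ^ 2 / (4 * a) = 0
    · refine Good.of_iso (iso_affine 1 0 (-α / (2 * a)) 0 1 0 a ?_ ha ?_ ?_ ?_ ?_ ?_ ?_ ?_) g7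
      case refine_8 => refine Eq.trans ?_ (h.trans (mul_zero _).symm); field_simp; ring
      all_goals field_simp <;> ring_nf <;> simp
    · obtain ⟨s, hs⟩ := exists_sq (-(γ - α ^ 2 / (4 * a)) / a)
      have hs0 : s ≠ 0 := by
        rintro rfl
        rw [zero_mul, eq_comm, div_eq_zero_iff, neg_eq_zero] at hs
        tauto
      have hs' : a * s * s = -(γ - α ^ 2 / (4 * a)) := by
        rw [mul_assoc, hs]; field_simp
      refine Good.of_iso (iso_affine s 0 (-α / (2 * a)) 0 1 0 (a * s * s) ?_ (by simp [ha, hs0])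
        ?_ ?_ ?_ ?_ ?_ ?_ ?_) g8
      case refine_8 => rw [hs']; field_simp; ring
      all_goals field_simp <;> ring_nf <;> simp [hs0]
  · refine Good.of_iso (iso_affine 1 0 0 (-α / β) (a / β) (-γ / β) a ?_ ha
      ?_ ?_ ?_ ?_ ?_ ?_ ?_) g6
    case refine_1 => simpa using ⟨ha, hβ⟩
    all_goals field_simp <;> ring_nf <;> simp

lemma case_a0 (b c d α β γ : k) (h : ¬(b = 0 ∧ c = 0 ∧ d = 0)) : Good k (Q 0 b c d α β γ) := by
  by_cases hbc : b + c = 0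
  · obtain rfl : c = -b := by linear_combination hbc
    by_cases hb : b = 0
    · subst hb
      have hd : d ≠ 0 := by simpa using h
      refine Good.of_iso (iso_affine 0 1 0 1 0 0 1 ?_ one_ne_zero ?_ ?_ ?_ ?_ ?_ ?_ ?_)
        (case_xx d β α γ hd) <;> simp
    · by_cases hd : d = 0
      · subst hd
        exact case_comm b α β γ hb
      · exact case_jordan b d α β γ hb hd
  · have key : Good k (Q 0 b c 0 α (β - α * d / (b + c)) γ) := by
      by_cases hb : b = 0
      · subst hb
        exact case_yx c _ _ _ (by simpa using hbc)
      · by_cases hc : c = 0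
        · subst hc
          exact Good.of_iso (iso_affine 0 1 0 1 0 0 1 (by simp) one_ne_zero (by simp) (by simp)
            (by simp) (by simp) (by simp; rfl) (by simp; rfl) (by simp; rfl))
            (case_yx b _ _ _ hb)
        · exact case_q b c _ _ _ hb hc hbc
    refine Good.of_iso (iso_affine 1 (-d / (b + c)) 0 0 1 0 1 ?_ one_ne_zero ?_ ?_ ?_ ?_ ?_ ?_ ?_)
      key
    case refine_1 => simp
    all_goals field_simp <;> ring_nf <;> simp

lemma case_all (a b c d α β γ : k) (h : ¬(a = 0 ∧ b = 0 ∧ c = 0 ∧ d = 0)) :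
    Good k (Q a b c d α β γ) := by
  by_cases ha : a = 0
  · subst ha
    exact case_a0 _ _ _ _ _ _ (by simpa using h)
  · obtain ⟨s, hs⟩ := exists_sq ((b + c) ^ 2 - 4 * a * d)
    obtain ⟨z, hz⟩ : ∃ z : k, a * z * z + (b + c) * z + d = 0 := by
      refine ⟨(-(b + c) + s) / (2 * a), ?_⟩
      field_simp
      linear_combination hs
    refine Good.of_iso (iso_affine z 1 0 1 0 0 1 (by simp) one_ne_zero
      (a' := 0) (b' := a * z + c) (c' := a * z + b) (d' := a)
      (α' := α * z + β) (β' := α) (γ' := γ) ?_ ?_ ?_ ?_ ?_ ?_ ?_) (case_a0 _ _ _ _ _ _ ?_)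
    case refine_8 => tauto
    case refine_1 => linear_combination hz
    all_goals ring

end

theorem stmt_14 (k : Type*) [Field k] [IsAlgClosed k] [CharZero k]
    (a b c d α β γ : k) (hdeg : ¬(a = 0 ∧ b = 0 ∧ c = 0 ∧ d = 0))
    (f : FreeAlgebra k (Fin 2))
    (hf : f = a • (X k * X k) + b • (X k * Y k) + c • (Y k * X k) + d • (Y k * Y k)
      + α • X k + β • Y k + γ • (1 : FreeAlgebra k (Fin 2))) :
    (∃ q : k, q ≠ 0 ∧
      Nonempty (QuotAlg k f ≃ₐ[k] QuotAlg k (X k * Y k - q • (Y k * X k)))) ∨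
    (∃ q : k, q ≠ 0 ∧
      Nonempty (QuotAlg k f ≃ₐ[k] QuotAlg k (X k * Y k - q • (Y k * X k) - 1))) ∨
    Nonempty (QuotAlg k f ≃ₐ[k] QuotAlg k (Y k * X k - X k * Y k + Y k * Y k)) ∨
    Nonempty (QuotAlg k f ≃ₐ[k] QuotAlg k (Y k * X k - X k * Y k + Y k * Y k + 1)) ∨
    Nonempty (QuotAlg k f ≃ₐ[k] QuotAlg k (Y k * X k - X k * Y k + Y k)) ∨
    Nonempty (QuotAlg k f ≃ₐ[k] QuotAlg k (X k * X k + Y k)) ∨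
    Nonempty (QuotAlg k f ≃ₐ[k] QuotAlg k (X k * X k)) ∨
    Nonempty (QuotAlg k f ≃ₐ[k] QuotAlg k (X k * X k - 1)) ∨
    Nonempty (QuotAlg k f ≃ₐ[k] QuotAlg k (Y k * X k)) ∨
    Nonempty (QuotAlg k f ≃ₐ[k] QuotAlg k (Y k * X k - 1)) := by
  subst hf
  exact case_all a b c d α β γ hdeg
end
end

section
/- Let k be an algebraically closed field of characteristic zero. The four k-algebras R_{yx} = k⟨x,y | yx⟩, R_{x²} = k⟨x,y | x²⟩, R_{x²−1} = k⟨x,y | x² − 1⟩, and 𝒮 = k⟨x,y | yx − 1⟩ are pairwise non-isomorphic as k-algebras. -/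
noncomputable section

namespace Aux16

variable {k : Type*} [Field k]

def gx (f : FreeAlgebra k (Fin 2)) : QuotAlg k f := RingQuot.mkAlgHom k (relOf k f) (X k)
def gy (f : FreeAlgebra k (Fin 2)) : QuotAlg k f := RingQuot.mkAlgHom k (relOf k f) (Y k)

theorem mk_rel (f : FreeAlgebra k (Fin 2)) : RingQuot.mkAlgHom k (relOf k f) f = 0 := by
  have := RingQuot.mkAlgHom_rel k (s := relOf k f) (x := f) (y := 0) ⟨rfl, rfl⟩
  simpa using this

theorem exists_lift {f : FreeAlgebra k (Fin 2)} {B : Type*} [Ring B] [Algebra k B] (a b : B)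
    (h : FreeAlgebra.lift k ![a, b] f = 0) :
    ∃ φ : QuotAlg k f →ₐ[k] B, φ (gx f) = a ∧ φ (gy f) = b := by
  refine ⟨RingQuot.liftAlgHom k ⟨FreeAlgebra.lift k ![a, b], ?_⟩, ?_, ?_⟩
  · rintro p q ⟨rfl, rfl⟩
    simpa using h
  · simp [gx, X]
  · simp [gy, Y]

theorem hom_ext' {f : FreeAlgebra k (Fin 2)} {B : Type*} [Ring B] [Algebra k B]
    {φ ψ : QuotAlg k f →ₐ[k] B} (hx : φ (gx f) = ψ (gx f)) (hy : φ (gy f) = ψ (gy f)) :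
    φ = ψ := by
  apply RingQuot.ringQuot_ext'
  apply FreeAlgebra.hom_ext
  funext i
  fin_cases i
  · exact hx
  · exact hy

/-- Some homomorphism to `D` has kernel contained in the kernel of every character. -/
def Q (k D A : Type*) [Field k] [Ring D] [Algebra k D] [Ring A] [Algebra k A] : Prop :=
  ∃ g : A →ₐ[k] D, ∀ χ : A →ₐ[k] k, ∀ a, g a = 0 → χ a = 0

/-- A square root of one is separated by characters. -/
def P (k A : Type*) [Field k] [Ring A] [Algebra k A] : Prop :=
  ∃ u : A, u * u = 1 ∧ ∃ χ ψ : A →ₐ[k] k, χ u ≠ ψ u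

theorem Q.transfer {D A B : Type*} [Ring D] [Algebra k D] [Ring A] [Algebra k A]
    [Ring B] [Algebra k B] (e : A ≃ₐ[k] B) (h : Q k D A) : Q k D B := by
  obtain ⟨g, hg⟩ := h
  refine ⟨g.comp e.symm.toAlgHom, fun χ a ha => ?_⟩
  have := hg (χ.comp e.toAlgHom) (e.symm a) ha
  simpa using this

theorem P.transfer {A B : Type*} [Ring A] [Algebra k A]
    [Ring B] [Algebra k B] (e : A ≃ₐ[k] B) (h : P k A) : P k B := by
  obtain ⟨u, hu, χ, ψ, hn⟩ := h
  refine ⟨e u, by rw [← map_mul, hu, map_one], χ.comp e.symm.toAlgHom, ψ.comp e.symm.toAlgHom, ?_⟩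
  simpa using hn

theorem rel_yx : gy (Y k * X k) * gx (Y k * X k) = 0 := by
  rw [gx, gy, ← map_mul]; exact mk_rel _

theorem rel_xx : gx (X k * X k) * gx (X k * X k) = 0 := by
  rw [gx, ← map_mul]; exact mk_rel _

theorem rel_xx1 : gx (X k * X k - 1) * gx (X k * X k - 1) = 1 := by
  have := mk_rel (X k * X k - 1)
  rw [map_sub, map_mul, map_one] at this
  exact sub_eq_zero.1 this

theorem rel_yx1 : gy (Y k * X k - 1) * gx (Y k * X k - 1) = 1 := by
  have := mk_rel (Y k * X k - 1)
  rw [map_sub, map_mul, map_one] at this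
  exact sub_eq_zero.1 this

theorem Q_xx : Q k (Polynomial k) (QuotAlg k (X k * X k)) := by
  obtain ⟨g, hx, hy⟩ := exists_lift (f := X k * X k) (0 : (Polynomial k)) Polynomial.X (by simp [X])
  refine ⟨g, fun χ a ha => ?_⟩
  have h : χ = (Polynomial.aeval (χ (gy _))).comp g := by
    apply hom_ext'
    · have := congrArg χ (rel_xx (k := k))
      rw [map_mul, map_zero, mul_self_eq_zero] at this
      simp [hx, this]
    · simp [hy]
  rw [h]; simp [ha]

theorem Q_yx1 : Q k (LaurentPolynomial k) (QuotAlg k (Y k * X k - 1)) := by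
  obtain ⟨g, hx, hy⟩ := exists_lift (f := Y k * X k - 1) (LaurentPolynomial.T 1 : LaurentPolynomial k)
    (LaurentPolynomial.T (-1)) (by
      have h := LaurentPolynomial.T_add (R := k) (-1) 1
      simp only [neg_add_cancel, LaurentPolynomial.T_zero] at h
      simp [X, Y, -LaurentPolynomial.T_mul, ← h])
  refine ⟨g, fun χ a ha => ?_⟩
  have h1 := congrArg χ (rel_yx1 (k := k))
  rw [map_mul, map_one] at h1
  let u : kˣ := ⟨χ (gx _), χ (gy _), by rw [mul_comm]; exact h1, h1⟩
  let E : LaurentPolynomial k →+* k := LaurentPolynomial.eval₂ (RingHom.id k) u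
  let E' : LaurentPolynomial k →ₐ[k] k := { E with
    commutes' := fun r => by
      change E (LaurentPolynomial.C r) = r
      simp [E] }
  have h : χ = E'.comp g := by
    apply hom_ext'
    · change _ = E (g _)
      rw [hx]; simp [E, u]
    · change _ = E (g _)
      rw [hy]; simp [E, u]
  rw [h]; simp [ha]

theorem nQ_yx {D : Type*} [CommRing D] [IsDomain D] [Algebra k D] :
    ¬ Q k D (QuotAlg k (Y k * X k)) := by
  rintro ⟨g, hg⟩
  have h := congrArg g (rel_yx (k := k))
  rw [map_mul, map_zero, mul_eq_zero] at h
  rcases h with h | h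
  · obtain ⟨χ, hx, hy⟩ := exists_lift (f := Y k * X k) (0 : k) 1 (by simp [X, Y])
    have := hg χ _ h
    simp [hy] at this
  · obtain ⟨χ, hx, hy⟩ := exists_lift (f := Y k * X k) (1 : k) 0 (by simp [X, Y])
    have := hg χ _ h
    simp [hx] at this

theorem nQ_xx1 [CharZero k] {D : Type*} [CommRing D] [IsDomain D] [Algebra k D] :
    ¬ Q k D (QuotAlg k (X k * X k - 1)) := by
  rintro ⟨g, hg⟩
  have h := congrArg g (rel_xx1 (k := k))
  rw [map_mul, map_one, mul_self_eq_one_iff] at h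
  obtain ⟨χ, hx, hy⟩ := exists_lift (f := X k * X k - 1) (1 : k) 0 (by simp [X])
  obtain ⟨ψ, hx', hy'⟩ := exists_lift (f := X k * X k - 1) (-1 : k) 0 (by simp [X])
  rcases h with h | h
  · have := hg ψ (gx _ - 1) (by simp [h])
    rw [map_sub, hx', map_one] at this
    norm_num at this
  · have := hg χ (gx _ + 1) (by simp [h])
    rw [map_add, hx, map_one] at this
    norm_num at this

theorem nQ_yx1 [CharZero k] : ¬ Q k (Polynomial k) (QuotAlg k (Y k * X k - 1)) := by
  rintro ⟨g, hg⟩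
  have h := congrArg g (rel_yx1 (k := k))
  rw [map_mul, map_one] at h
  have hu : IsUnit (g (gx (Y k * X k - 1))) := IsUnit.of_mul_eq_one_right _ h
  obtain ⟨c, -, hc⟩ := Polynomial.isUnit_iff.1 hu
  have key : ∀ χ : QuotAlg k (Y k * X k - 1) →ₐ[k] k, χ (gx _) = c := by
    intro χ
    have := hg χ (gx _ - algebraMap k _ c) (by
      rw [map_sub, ← hc, AlgHom.commutes]; simp)
    rw [map_sub, AlgHom.commutes] at this
    exact sub_eq_zero.1 this
  obtain ⟨χ, hx, hy⟩ := exists_lift (f := Y k * X k - 1) (1 : k) 1 (by simp [X, Y])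
  obtain ⟨ψ, hx', hy'⟩ := exists_lift (f := Y k * X k - 1) (-1 : k) (-1) (by simp [X, Y])
  have h1 := key χ
  have h2 := key ψ
  rw [hx] at h1
  rw [hx', ← h1] at h2
  norm_num at h2

theorem P_xx1 [CharZero k] : P k (QuotAlg k (X k * X k - 1)) := by
  obtain ⟨χ, hx, hy⟩ := exists_lift (f := X k * X k - 1) (1 : k) 0 (by simp [X])
  obtain ⟨ψ, hx', hy'⟩ := exists_lift (f := X k * X k - 1) (-1 : k) 0 (by simp [X])
  refine ⟨gx _, rel_xx1, χ, ψ, ?_⟩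
  rw [hx, hx']
  norm_num

theorem const_of_sq {p : (Polynomial k)} (h : p * p = 1) (a b : k) :
    Polynomial.aeval a p = Polynomial.aeval b p := by
  rcases mul_self_eq_one_iff.1 h with h | h <;> simp [h]

theorem nP_yx : ¬ P k (QuotAlg k (Y k * X k)) := by
  rintro ⟨u, hu, χ, ψ, hn⟩
  obtain ⟨g, gx1, gy1⟩ := exists_lift (f := Y k * X k) (Polynomial.X : (Polynomial k)) 0 (by simp [X, Y])
  obtain ⟨g', gx2, gy2⟩ := exists_lift (f := Y k * X k) (0 : (Polynomial k)) Polynomial.X (by simp [X, Y])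
  obtain ⟨ω, ox, oy⟩ := exists_lift (f := Y k * X k) (0 : k) 0 (by simp [X, Y])
  have hg : g u * g u = 1 := by rw [← map_mul, hu, map_one]
  have hg' : g' u * g' u = 1 := by rw [← map_mul, hu, map_one]
  have key : ∀ φ : QuotAlg k (Y k * X k) →ₐ[k] k, φ u = ω u := by
    intro φ
    have h := congrArg φ (rel_yx (k := k))
    rw [map_mul, map_zero, mul_eq_zero] at h
    rcases h with h | h
    · have e1 : φ = (Polynomial.aeval (φ (gx _))).comp g :=
        hom_ext' (by simp [gx1]) (by simp [gy1, h])
      have e2 : ω = (Polynomial.aeval (0 : k)).comp g :=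
        hom_ext' (by simp [gx1, ox]) (by simp [gy1, oy])
      rw [e1, e2]
      exact const_of_sq hg _ _
    · have e1 : φ = (Polynomial.aeval (φ (gy _))).comp g' :=
        hom_ext' (by simp [gx2, h]) (by simp [gy2])
      have e2 : ω = (Polynomial.aeval (0 : k)).comp g' :=
        hom_ext' (by simp [gx2, ox]) (by simp [gy2, oy])
      rw [e1, e2]
      exact const_of_sq hg' _ _
  exact hn ((key χ).trans (key ψ).symm)

end Aux16

theorem stmt_16 (k : Type*) [Field k] [IsAlgClosed k] [CharZero k] :
    IsEmpty (QuotAlg k (Y k * X k) ≃ₐ[k] QuotAlg k (X k * X k)) ∧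
    IsEmpty (QuotAlg k (Y k * X k) ≃ₐ[k] QuotAlg k (X k * X k - 1)) ∧
    IsEmpty (QuotAlg k (Y k * X k) ≃ₐ[k] QuotAlg k (Y k * X k - 1)) ∧
    IsEmpty (QuotAlg k (X k * X k) ≃ₐ[k] QuotAlg k (X k * X k - 1)) ∧
    IsEmpty (QuotAlg k (X k * X k) ≃ₐ[k] QuotAlg k (Y k * X k - 1)) ∧
    IsEmpty (QuotAlg k (X k * X k - 1) ≃ₐ[k] QuotAlg k (Y k * X k - 1)) := by
  exact ⟨⟨fun e => Aux16.nQ_yx (Aux16.Q_xx.transfer e.symm)⟩,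
    ⟨fun e => Aux16.nP_yx (Aux16.P_xx1.transfer e.symm)⟩,
    ⟨fun e => Aux16.nQ_yx (Aux16.Q_yx1.transfer e.symm)⟩,
    ⟨fun e => Aux16.nQ_xx1 (Aux16.Q_xx.transfer e)⟩,
    ⟨fun e => Aux16.nQ_yx1 (Aux16.Q_xx.transfer e)⟩,
    ⟨fun e => Aux16.nQ_xx1 (Aux16.Q_yx1.transfer e.symm)⟩⟩
end
end
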